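/- Let p ∈ [0,1] and let K₀ = √(1−p)·I₂, K₁ = √p·[[1,0],[0,0]], K₂ = √p·[[0,0],[0,1]] be the Kraus operators of the qubit dephasing channel. Set ρ' = Σᵢ₌₀² (Kᵢ⊗I₂)·ρ_AB·(Kᵢ⊗I₂)†, the state with the dephasing channel applied to the first qubit. Then tr[ρ'·𝔅] = (12 − 8p)/√3. -/

import Mathlib

open Matrix Kronecker
open scoped ComplexOrder

noncomputable def σx : Matrix (Fin 2) (Fin 2) ℂ := !![0, 1; 1, 0]
noncomputable def σy : Matrix (Fin 2) (Fin 2) ℂ := !![0, -Complex.I; Complex.I, 0]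
noncomputable def σz : Matrix (Fin 2) (Fin 2) ℂ := !![1, 0; 0, -1]

/-- Bob's observables for the Elegant Bell inequality. -/
noncomputable def B1 : Matrix (Fin 2) (Fin 2) ℂ := (Real.sqrt 3 : ℂ)⁻¹ • (σx - σy + σz)
noncomputable def B2 : Matrix (Fin 2) (Fin 2) ℂ := (Real.sqrt 3 : ℂ)⁻¹ • (σx + σy - σz)
noncomputable def B3 : Matrix (Fin 2) (Fin 2) ℂ := (Real.sqrt 3 : ℂ)⁻¹ • (-σx - σy - σz)
noncomputable def B4 : Matrix (Fin 2) (Fin 2) ℂ := (Real.sqrt 3 : ℂ)⁻¹ • (-σx + σy + σz)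

/-- The EBI Bell operator 𝔅 with Alice's observables A₁ = σx, A₂ = σy, A₃ = σz. -/
noncomputable def EBIop : Matrix (Fin 2 × Fin 2) (Fin 2 × Fin 2) ℂ :=
  σx ⊗ₖ (B1 + B2 - B3 - B4) + σy ⊗ₖ (B1 - B2 + B3 - B4) + σz ⊗ₖ (B1 - B2 - B3 + B4)

/-- The maximally entangled two-qubit state. -/
noncomputable def ρAB : Matrix (Fin 2 × Fin 2) (Fin 2 × Fin 2) ℂ :=
  (4 : ℂ)⁻¹ • ((1 : Matrix (Fin 2) (Fin 2) ℂ) ⊗ₖ (1 : Matrix (Fin 2) (Fin 2) ℂ)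
    + σx ⊗ₖ σx - σy ⊗ₖ σy + σz ⊗ₖ σz)

/-- Kraus operators of the qubit dephasing channel with parameter `p`. -/
noncomputable def dephK (p : ℝ) : Fin 3 → Matrix (Fin 2) (Fin 2) ℂ :=
  ![(Real.sqrt (1 - p) : ℂ) • (1 : Matrix (Fin 2) (Fin 2) ℂ),
    (Real.sqrt p : ℂ) • !![1, 0; 0, 0],
    (Real.sqrt p : ℂ) • !![0, 0; 0, 1]]

theorem EBIop_eq : EBIop = (4 * (Real.sqrt 3 : ℂ)⁻¹) • (σx ⊗ₖ σx - σy ⊗ₖ σy + σz ⊗ₖ σz) := by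
  have h1 : B1 + B2 - B3 - B4 = (4 * (Real.sqrt 3 : ℂ)⁻¹) • σx := by
    unfold B1 B2 B3 B4; module
  have h2 : B1 - B2 + B3 - B4 = -((4 * (Real.sqrt 3 : ℂ)⁻¹) • σy) := by
    unfold B1 B2 B3 B4; module
  have h3 : B1 - B2 - B3 + B4 = (4 * (Real.sqrt 3 : ℂ)⁻¹) • σz := by
    unfold B1 B2 B3 B4; module
  have hneg : σy ⊗ₖ (-((4 * (Real.sqrt 3 : ℂ)⁻¹) • σy))
      = -((4 * (Real.sqrt 3 : ℂ)⁻¹) • σy ⊗ₖ σy) := by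
    rw [← neg_smul, kronecker_smul, neg_smul]
  rw [EBIop, h1, h2, h3, hneg, kronecker_smul, kronecker_smul]
  module

/-- The dephasing channel keeps the diagonal and damps the off-diagonal entries by `1 - p`. -/
theorem sum_dephK_conj {p : ℝ} (hp0 : 0 ≤ p) (hp1 : p ≤ 1) (M : Matrix (Fin 2) (Fin 2) ℂ) :
    ∑ i : Fin 3, dephK p i * M * (dephK p i)ᴴ
      = !![M 0 0, (1 - p) * M 0 1; (1 - p) * M 1 0, M 1 1] := by
  have hp : (Real.sqrt p : ℂ) * Real.sqrt p = p := by
    exact_mod_cast Real.mul_self_sqrt hp0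
  have hq : (Real.sqrt (1 - p) : ℂ) * Real.sqrt (1 - p) = 1 - p := by
    exact_mod_cast Real.mul_self_sqrt (sub_nonneg.mpr hp1)
  ext i j
  fin_cases i <;> fin_cases j <;>
    simp [Fin.sum_univ_three, dephK, Matrix.mul_apply, vecMul, dotProduct, smul_smul, hq]
  · linear_combination M 0 0 * hp
  · linear_combination M 1 1 * hp

theorem sum_dephK_kronecker_conj (p : ℝ) (M N : Matrix (Fin 2) (Fin 2) ℂ) :
    ∑ i : Fin 3, (dephK p i ⊗ₖ (1 : Matrix (Fin 2) (Fin 2) ℂ)) * (M ⊗ₖ N)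
        * (dephK p i ⊗ₖ (1 : Matrix (Fin 2) (Fin 2) ℂ))ᴴ
      = (∑ i : Fin 3, dephK p i * M * (dephK p i)ᴴ) ⊗ₖ N := by
  simp only [conjTranspose_kronecker, ← mul_kronecker_mul, conjTranspose_one, one_mul, mul_one,
    Fin.sum_univ_three, add_kronecker]

/-- The maximally entangled state after dephasing of the first qubit. -/
theorem sum_dephK_conj_ρAB {p : ℝ} (hp0 : 0 ≤ p) (hp1 : p ≤ 1) :
    ∑ i : Fin 3, (dephK p i ⊗ₖ (1 : Matrix (Fin 2) (Fin 2) ℂ)) * ρAB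
        * (dephK p i ⊗ₖ (1 : Matrix (Fin 2) (Fin 2) ℂ))ᴴ
      = (4 : ℂ)⁻¹ • ((1 : Matrix (Fin 2) (Fin 2) ℂ) ⊗ₖ (1 : Matrix (Fin 2) (Fin 2) ℂ)
        + (1 - p : ℂ) • σx ⊗ₖ σx - (1 - p : ℂ) • σy ⊗ₖ σy + σz ⊗ₖ σz) := by
  have h1 : ∑ i : Fin 3, dephK p i * 1 * (dephK p i)ᴴ = 1 := by
    rw [sum_dephK_conj hp0 hp1]; ext i j; fin_cases i <;> fin_cases j <;> simp
  have hx : ∑ i : Fin 3, dephK p i * σx * (dephK p i)ᴴ = (1 - p : ℂ) • σx := by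
    rw [sum_dephK_conj hp0 hp1]; ext i j; fin_cases i <;> fin_cases j <;> simp [σx]
  have hy : ∑ i : Fin 3, dephK p i * σy * (dephK p i)ᴴ = (1 - p : ℂ) • σy := by
    rw [sum_dephK_conj hp0 hp1]; ext i j; fin_cases i <;> fin_cases j <;> simp [σy]
  have hz : ∑ i : Fin 3, dephK p i * σz * (dephK p i)ᴴ = σz := by
    rw [sum_dephK_conj hp0 hp1]; ext i j; fin_cases i <;> fin_cases j <;> simp [σz]
  simp only [ρAB, Matrix.mul_smul, Matrix.smul_mul, Matrix.mul_add, Matrix.add_mul,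
    Matrix.mul_sub, Matrix.sub_mul, ← Finset.smul_sum, Finset.sum_add_distrib,
    Finset.sum_sub_distrib, sum_dephK_kronecker_conj, h1, hx, hy, hz, smul_kronecker]

/-- Applying the dephasing channel to the first qubit of the maximally
entangled state gives EBI value `(12 − 8p)/√3`. -/
theorem dephasing_first_qubit_EBI_value (p : ℝ) (hp0 : 0 ≤ p) (hp1 : p ≤ 1) :
    ((∑ i : Fin 3, (dephK p i ⊗ₖ (1 : Matrix (Fin 2) (Fin 2) ℂ)) * ρAB
        * (dephK p i ⊗ₖ (1 : Matrix (Fin 2) (Fin 2) ℂ))ᴴ) * EBIop).trace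
      = (((12 - 8 * p) / Real.sqrt 3 : ℝ) : ℂ) := by
  rw [sum_dephK_conj_ρAB hp0 hp1, EBIop_eq]
  simp only [Matrix.mul_smul, Matrix.smul_mul, Matrix.mul_add, Matrix.add_mul,
    Matrix.mul_sub, Matrix.sub_mul, ← mul_kronecker_mul, trace_smul, trace_add, trace_sub,
    trace_kronecker, one_mul]
  simp [σx, σy, σz, trace_fin_two]
  ring
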